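/- Let Ω ⊂ ℝ² be a bounded, open, simply connected domain satisfying Assumption (R), and let ψ₀ be the scalar potential of B. If ψ₀(x) < 0 for every x ∈ Ω, then lim_{h→0⁺} h·log λ₋^D(h,B,Ω) = 2·inf_Ω ψ₀. -/

import Mathlib

open MeasureTheory Set Filter Topology

noncomputable section

/-- First partial derivative (in the direction `x₁`) of a function on `ℝ × ℝ`. -/
def pd1 {E : Type*} [NormedAddCommGroup E] [NormedSpace ℝ E] (u : ℝ × ℝ → E) (x : ℝ × ℝ) : E :=
  fderiv ℝ u x (1, 0)

/-- Second partial derivative (in the direction `x₂`) of a function on `ℝ × ℝ`. -/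
def pd2 {E : Type*} [NormedAddCommGroup E] [NormedSpace ℝ E] (u : ℝ × ℝ → E) (x : ℝ × ℝ) : E :=
  fderiv ℝ u x (0, 1)

/-- The Laplacian on `ℝ × ℝ`. -/
def lap (ψ : ℝ × ℝ → ℝ) (x : ℝ × ℝ) : ℝ := pd1 (pd1 ψ) x + pd2 (pd2 ψ) x

/-- Test functions for the Dirichlet variational problems on `Ω`:
nonzero smooth compactly supported functions with support in `Ω`. -/
def IsTestFun (Ω : Set (ℝ × ℝ)) (u : ℝ × ℝ → ℂ) : Prop :=
  ContDiff ℝ (⊤ : ℕ∞) u ∧ HasCompactSupport u ∧ tsupport u ⊆ Ω ∧ u ≠ 0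

/-- Rayleigh quotient of the spin-`σ` (`σ = -1` : spin-down, `σ = 1` : spin-up)
Dirichlet Pauli operator at the test function `u`. -/
def pauliRayleigh (σ : ℝ) (h : ℝ) (A : ℝ × ℝ → ℝ × ℝ) (B : ℝ × ℝ → ℝ) (Ω : Set (ℝ × ℝ))
    (u : ℝ × ℝ → ℂ) : ℝ :=
  ((∫ x in Ω, (‖(h : ℂ) * pd1 u x - Complex.I * ((A x).1 : ℂ) * u x‖ ^ 2
      + ‖(h : ℂ) * pd2 u x - Complex.I * ((A x).2 : ℂ) * u x‖ ^ 2))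
    + σ * (h * ∫ x in Ω, B x * ‖u x‖ ^ 2)) / ∫ x in Ω, ‖u x‖ ^ 2

/-- The ground state energy `λ₋^D(h,A,B,Ω)` of the spin-down Dirichlet Pauli operator. -/
def lambdaMinusD (h : ℝ) (A : ℝ × ℝ → ℝ × ℝ) (B : ℝ × ℝ → ℝ) (Ω : Set (ℝ × ℝ)) : ℝ :=
  sInf (pauliRayleigh (-1) h A B Ω '' {u | IsTestFun Ω u})

/-- The ground state energy `λ₊^D(h,A,B,Ω)` of the spin-up Dirichlet Pauli operator. -/
def lambdaPlusD (h : ℝ) (A : ℝ × ℝ → ℝ × ℝ) (B : ℝ × ℝ → ℝ) (Ω : Set (ℝ × ℝ)) : ℝ :=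
  sInf (pauliRayleigh 1 h A B Ω '' {u | IsTestFun Ω u})

/-- The ground state energy `Λ^D(h,A,B,Ω)` of the full Dirichlet Pauli operator. -/
def LambdaD (h : ℝ) (A : ℝ × ℝ → ℝ × ℝ) (B : ℝ × ℝ → ℝ) (Ω : Set (ℝ × ℝ)) : ℝ :=
  min (lambdaMinusD h A B Ω) (lambdaPlusD h A B Ω)

/-- The canonical vector potential `∇⊥ψ = (−∂₂ψ, ∂₁ψ)`. -/
def perpGrad (ψ : ℝ × ℝ → ℝ) (x : ℝ × ℝ) : ℝ × ℝ := (-(pd2 ψ x), pd1 ψ x)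

/-- `ψ` is the scalar potential of `B` on `Ω`: `ψ ∈ C⁰(closure Ω) ∩ C²(Ω)`,
`Δψ = B` in `Ω` and `ψ = 0` on `∂Ω`. -/
structure IsScalarPotential (Ω : Set (ℝ × ℝ)) (B : ℝ × ℝ → ℝ) (ψ : ℝ × ℝ → ℝ) : Prop where
  contOn : ContinuousOn ψ (closure Ω)
  c2 : ContDiffOn ℝ 2 ψ Ω
  lap_eq : ∀ x ∈ Ω, lap ψ x = B x
  bdry : ∀ x ∈ frontier Ω, ψ x = 0

/-- `A` is a continuous vector potential for `B` on `Ω`: `∂₁A₂ − ∂₂A₁ = B`. -/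
def IsVectorPotential (Ω : Set (ℝ × ℝ)) (B : ℝ × ℝ → ℝ) (A : ℝ × ℝ → ℝ × ℝ) : Prop :=
  ContinuousOn A Ω ∧ ∀ x ∈ Ω, pd1 (fun y => (A y).2) x - pd2 (fun y => (A y).1) x = B x

/-- `γ` is a regular curve of class `C^{2,α}` on the parameter set `s`. -/
def C2HolderOn (α : ℝ) (γ : ℝ → ℝ × ℝ) (s : Set ℝ) : Prop :=
  ContDiffOn ℝ 2 γ s ∧
  (∃ C : ℝ, ∀ x ∈ s, ∀ y ∈ s,
      ‖derivWithin (derivWithin γ s) s x - derivWithin (derivWithin γ s) s y‖ ≤ C * |x - y| ^ α) ∧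
  ∀ x ∈ s, derivWithin γ s x ≠ 0

/-- Near `p`, the set `Γ` is a regular curve of class `C^{2,α}`. -/
def IsLocallyC2CurveAt (α : ℝ) (Γ : Set (ℝ × ℝ)) (p : ℝ × ℝ) : Prop :=
  ∃ ε > 0, ∃ γ : ℝ → ℝ × ℝ, C2HolderOn α γ (Icc (-1) 1) ∧ γ 0 = p ∧
    Γ ∩ Metric.ball p ε = γ '' Ioo (-1) 1 ∩ Metric.ball p ε

/-- `Γ` is (locally) a regular curve of class `C^{2,α}`. -/
def IsC2HolderSet (α : ℝ) (Γ : Set (ℝ × ℝ)) : Prop := ∀ p ∈ Γ, IsLocallyC2CurveAt α Γ p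

/-- `Ω` has a corner at `p` formed by two `C^{2,α}` arcs, of aperture less than `π`
(near `p`, `Ω` is contained in a strictly convex open cone with vertex `p`). -/
def HasConvexCornerAt (Ω : Set (ℝ × ℝ)) (α : ℝ) (p : ℝ × ℝ) : Prop :=
  ∃ ε > 0, (∃ γ₁ γ₂ : ℝ → ℝ × ℝ, C2HolderOn α γ₁ (Icc 0 1) ∧ C2HolderOn α γ₂ (Icc 0 1) ∧
      γ₁ 0 = p ∧ γ₂ 0 = p ∧
      frontier Ω ∩ Metric.ball p ε = (γ₁ '' Ico 0 1 ∪ γ₂ '' Ico 0 1) ∩ Metric.ball p ε) ∧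
    ∃ w : ℝ × ℝ, ∃ c > 0, ∀ x ∈ Ω ∩ Metric.ball p ε,
      c * ‖x - p‖ ≤ (x - p).1 * w.1 + (x - p).2 * w.2

/-- `Ω` has a continuous boundary which is piecewise of class `C^{2,α}` for some `α > 0`,
with at most finitely many corners, each of aperture less than `π`. -/
def HasPiecewiseC2Boundary (Ω : Set (ℝ × ℝ)) : Prop :=
  ∃ α > 0, ∃ S : Finset (ℝ × ℝ), ↑S ⊆ frontier Ω ∧
    (∀ p ∈ frontier Ω \ (S : Set (ℝ × ℝ)), IsLocallyC2CurveAt α (frontier Ω) p) ∧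
    ∀ p ∈ S, HasConvexCornerAt Ω α p

/-- Assumption (R): `Ω` is bounded and open with continuous, piecewise `C^{2,α}` boundary
having finitely many corners of aperture `< π`, and `B` extends continuously to `closure Ω`. -/
structure AssumptionR (Ω : Set (ℝ × ℝ)) (B : ℝ × ℝ → ℝ) : Prop where
  isOpen : IsOpen Ω
  bounded : Bornology.IsBounded Ω
  bdryReg : HasPiecewiseC2Boundary Ω
  fieldCont : ContinuousOn B (closure Ω)

/-- The oscillation of `ψ` over `Ω`. -/
def osc (ψ : ℝ × ℝ → ℝ) (Ω : Set (ℝ × ℝ)) : ℝ := sSup (ψ '' Ω) - sInf (ψ '' Ω)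

/-- The region enclosed by `Γ`: the union of the bounded connected components of `Γᶜ`. -/
def curveInterior (Γ : Set (ℝ × ℝ)) : Set (ℝ × ℝ) :=
  {x | x ∉ Γ ∧ Bornology.IsBounded (connectedComponentIn Γᶜ x)}

/-- `Γ` is a simple closed curve of class `C^{2,α}`. -/
def IsC2ClosedCurve (α : ℝ) (Γ : Set (ℝ × ℝ)) : Prop :=
  ∃ γ : ℝ → ℝ × ℝ, Function.Periodic γ 1 ∧ C2HolderOn α γ (Icc 0 1) ∧
    InjOn γ (Ico 0 1) ∧ Γ = γ '' Icc 0 1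

/-- The ground state energy `λ^D(Ω)` of the Dirichlet Laplacian on `Ω`. -/
def dirichletGSE (Ω : Set (ℝ × ℝ)) : ℝ :=
  sInf ((fun u : ℝ × ℝ → ℝ =>
      (∫ x in Ω, (pd1 u x ^ 2 + pd2 u x ^ 2)) / ∫ x in Ω, u x ^ 2) ''
    {u | ContDiff ℝ (⊤ : ℕ∞) u ∧ HasCompactSupport u ∧ tsupport u ⊆ Ω ∧ u ≠ 0})

/-- The open disc of radius `R` centred at the origin (with the Euclidean distance). -/
def disc (R : ℝ) : Set (ℝ × ℝ) := {y : ℝ × ℝ | y.1 ^ 2 + y.2 ^ 2 < R ^ 2}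

end

/-- The integral of a directional derivative of a compactly supported `C¹` function vanishes. -/
theorem integral_fderiv_apply_eq_zero {F : ℝ × ℝ → ℝ} (hF : ContDiff ℝ 1 F)
    (hc : HasCompactSupport F) (v : ℝ × ℝ) : ∫ x, fderiv ℝ F x v = 0 := by
  have h1 : Continuous fun x => fderiv ℝ F x v :=
    (hF.continuous_fderiv one_ne_zero).clm_apply continuous_const
  have h := integral_mul_fderiv_eq_neg_fderiv_mul_of_integrable (𝕜 := ℝ)
    (μ := (volume : Measure (ℝ × ℝ)))
    (f := fun _ => (1 : ℝ)) (g := F) (v := v) (by simp)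
    (by simpa using h1.integrable_of_hasCompactSupport (hc.fderiv_apply (𝕜 := ℝ) v))
    (by simpa using hF.continuous.integrable_of_hasCompactSupport hc)
    (fun _ _ => by fun_prop) (fun x _ => (hF.differentiable one_ne_zero) x)
  simpa using h

theorem ContDiff.fderiv_apply_const {E : Type*} [NormedAddCommGroup E] [NormedSpace ℝ E]
    {u : ℝ × ℝ → E} (hu : ContDiff ℝ 2 u) (v : ℝ × ℝ) :
    ContDiff ℝ 1 fun x => fderiv ℝ u x v :=
  (hu.fderiv_right (m := 1) (by norm_num [one_add_one_eq_two])).clm_apply contDiff_const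

theorem fderiv_fderiv_apply_comm {E : Type*} [NormedAddCommGroup E] [NormedSpace ℝ E]
    {u : ℝ × ℝ → E} (hu : ContDiff ℝ 2 u) (v w x : ℝ × ℝ) :
    fderiv ℝ (fun y => fderiv ℝ u y v) x w = fderiv ℝ (fun y => fderiv ℝ u y w) x v := by
  have hd : DifferentiableAt ℝ (fderiv ℝ u) x :=
    (hu.fderiv_right (m := 1) (by norm_num [one_add_one_eq_two])).differentiable one_ne_zero x
  have key : ∀ v w : ℝ × ℝ, fderiv ℝ (fun y => fderiv ℝ u y v) x w
      = fderiv ℝ (fderiv ℝ u) x w v := fun v w => by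
    rw [fderiv_clm_apply hd (by fun_prop)]
    simp
  rw [key, key]
  exact (hu.contDiffAt.isSymmSndFDerivAt (by simp)) w v

/-- The first component of the magnetic gradient with vector potential `∇⊥ψ`. -/
noncomputable def magGrad1 (h : ℝ) (ψ : ℝ × ℝ → ℝ) (u : ℝ × ℝ → ℂ) (x : ℝ × ℝ) : ℂ :=
  (h : ℂ) * pd1 u x - Complex.I * ((perpGrad ψ x).1 : ℂ) * u x

/-- The second component of the magnetic gradient with vector potential `∇⊥ψ`. -/
noncomputable def magGrad2 (h : ℝ) (ψ : ℝ × ℝ → ℝ) (u : ℝ × ℝ → ℂ) (x : ℝ × ℝ) : ℂ :=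
  (h : ℂ) * pd2 u x - Complex.I * ((perpGrad ψ x).2 : ℂ) * u x

theorem fderiv_re_apply {u : ℝ × ℝ → ℂ} {x : ℝ × ℝ} (hu : DifferentiableAt ℝ u x) (v : ℝ × ℝ) :
    fderiv ℝ (fun y => (u y).re) x v = (fderiv ℝ u x v).re := by
  have := (Complex.reCLM.hasFDerivAt.comp x hu.hasFDerivAt).fderiv
  exact congrArg (fun L => L v) this

theorem fderiv_im_apply {u : ℝ × ℝ → ℂ} {x : ℝ × ℝ} (hu : DifferentiableAt ℝ u x) (v : ℝ × ℝ) :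
    fderiv ℝ (fun y => (u y).im) x v = (fderiv ℝ u x v).im := by
  have := (Complex.imCLM.hasFDerivAt.comp x hu.hasFDerivAt).fderiv
  exact congrArg (fun L => L v) this

/-- Factorization of the Pauli form, obtained by integrating by parts. -/
theorem integral_magGrad_sq_sub_lap_eq {h : ℝ} {ψ : ℝ × ℝ → ℝ} {u : ℝ × ℝ → ℂ} (hψ : ContDiff ℝ 2 ψ)
    (hu : ContDiff ℝ 2 u) (hc : HasCompactSupport u) :
    (∫ x, (‖magGrad1 h ψ u x‖ ^ 2 + ‖magGrad2 h ψ u x‖ ^ 2)) - h * ∫ x, lap ψ x * ‖u x‖ ^ 2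
      = ∫ x, ‖magGrad1 h ψ u x + Complex.I * magGrad2 h ψ u x‖ ^ 2 := by
  set a : ℝ × ℝ → ℝ := fun x => (u x).re with ha
  set b : ℝ × ℝ → ℝ := fun x => (u x).im with hb
  have hda : ContDiff ℝ 2 a := Complex.reCLM.contDiff.comp hu
  have hdb : ContDiff ℝ 2 b := Complex.imCLM.contDiff.comp hu
  have hac : HasCompactSupport a := hc.comp_left (g := Complex.re) rfl
  have hbc : HasCompactSupport b := hc.comp_left (g := Complex.im) rfl
  have hda1 : ContDiff ℝ 1 a := hda.of_le (by norm_num)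
  have hdb1 : ContDiff ℝ 1 b := hdb.of_le (by norm_num)
  have a1 : ContDiff ℝ 1 (pd1 a) := hda.fderiv_apply_const _
  have a2 : ContDiff ℝ 1 (pd2 a) := hda.fderiv_apply_const _
  have p1 : ContDiff ℝ 1 (pd1 ψ) := hψ.fderiv_apply_const _
  have p2 : ContDiff ℝ 1 (pd2 ψ) := hψ.fderiv_apply_const _
  have u1 : ContDiff ℝ 1 (pd1 u) := hu.fderiv_apply_const _
  have u2 : ContDiff ℝ 1 (pd2 u) := hu.fderiv_apply_const _
  set G1 : ℝ × ℝ → ℝ := fun x =>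
    a x * (-h * a x * pd1 ψ x) + b x * (-h * b x * pd1 ψ x - 2 * h ^ 2 * pd2 a x) with hG1
  set G2 : ℝ × ℝ → ℝ := fun x =>
    a x * (-h * a x * pd2 ψ x) + b x * (-h * b x * pd2 ψ x + 2 * h ^ 2 * pd1 a x) with hG2
  have dG1 : ContDiff ℝ 1 G1 := by fun_prop
  have dG2 : ContDiff ℝ 1 G2 := by fun_prop
  have cG1 : HasCompactSupport G1 := hac.mul_right.add hbc.mul_right
  have cG2 : HasCompactSupport G2 := hac.mul_right.add hbc.mul_right
  have cu : Continuous u := hu.continuous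
  have cw : HasCompactSupport fun x => ‖u x‖ ^ 2 := hc.comp_left (g := fun z => ‖z‖ ^ 2) (by simp)
  have c1 : HasCompactSupport (magGrad1 h ψ u) :=
    HasCompactSupport.sub (hc.fderiv_apply (𝕜 := ℝ) _).mul_left hc.mul_left
  have c2 : HasCompactSupport (magGrad2 h ψ u) :=
    HasCompactSupport.sub (hc.fderiv_apply (𝕜 := ℝ) _).mul_left hc.mul_left
  have k1 : Continuous (magGrad1 h ψ u) := by
    have := u1.continuous; have := p2.continuous
    unfold magGrad1 perpGrad
    fun_prop
  have k2 : Continuous (magGrad2 h ψ u) := by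
    have := u2.continuous; have := p1.continuous
    unfold magGrad2 perpGrad
    fun_prop
  have kl : Continuous (lap ψ) := by
    have q1 : Continuous (pd1 (pd1 ψ)) :=
      (p1.continuous_fderiv one_ne_zero).clm_apply continuous_const
    have q2 : Continuous (pd2 (pd2 ψ)) :=
      (p2.continuous_fderiv one_ne_zero).clm_apply continuous_const
    exact q1.add q2
  have iA : Integrable fun x => ‖magGrad1 h ψ u x‖ ^ 2 + ‖magGrad2 h ψ u x‖ ^ 2 :=
    Continuous.integrable_of_hasCompactSupport (by fun_prop)
      ((c1.comp_left (g := fun z => ‖z‖ ^ 2) (by simp)).add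
        (c2.comp_left (g := fun z => ‖z‖ ^ 2) (by simp)))
  have iB : Integrable fun x => lap ψ x * ‖u x‖ ^ 2 :=
    Continuous.integrable_of_hasCompactSupport (by fun_prop) cw.mul_left
  have iC : Integrable fun x => ‖magGrad1 h ψ u x + Complex.I * magGrad2 h ψ u x‖ ^ 2 :=
    Continuous.integrable_of_hasCompactSupport (by fun_prop)
      ((c1.add c2.mul_left).comp_left (g := fun z => ‖z‖ ^ 2) (by simp))
  have point : ∀ x, ‖magGrad1 h ψ u x‖ ^ 2 + ‖magGrad2 h ψ u x‖ ^ 2 - h * (lap ψ x * ‖u x‖ ^ 2)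
      - ‖magGrad1 h ψ u x + Complex.I * magGrad2 h ψ u x‖ ^ 2
      = fderiv ℝ G1 x (1, 0) + fderiv ℝ G2 x (0, 1) := by
    intro x
    have fa := (hda1.differentiable one_ne_zero x).hasFDerivAt
    have fb := (hdb1.differentiable one_ne_zero x).hasFDerivAt
    have fa1 := (a1.differentiable one_ne_zero x).hasFDerivAt
    have fa2 := (a2.differentiable one_ne_zero x).hasFDerivAt
    have fp1 := (p1.differentiable one_ne_zero x).hasFDerivAt
    have fp2 := (p2.differentiable one_ne_zero x).hasFDerivAt
    have hud : DifferentiableAt ℝ u x := hu.differentiable (by norm_num) x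
    have e1 : fderiv ℝ G1 x = _ := ((fa.mul ((fa.const_mul (-h)).mul fp1)).add
      (fb.mul (((fb.const_mul (-h)).mul fp1).sub (fa2.const_mul (2 * h ^ 2))))).fderiv
    have e2 : fderiv ℝ G2 x = _ := ((fa.mul ((fa.const_mul (-h)).mul fp2)).add
      (fb.mul (((fb.const_mul (-h)).mul fp2).add (fa1.const_mul (2 * h ^ 2))))).fderiv
    have sym : fderiv ℝ (pd1 a) x (0, 1) = fderiv ℝ (pd2 a) x (1, 0) :=
      fderiv_fderiv_apply_comm hda _ _ _
    have ra := fderiv_re_apply hud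
    have rb := fderiv_im_apply hud
    rw [e1, e2]
    simp only [add_apply, sub_apply, smul_apply, smul_eq_mul, Pi.add_apply, Pi.sub_apply,
      Pi.mul_apply]
    rw [sym]
    simp only [lap, magGrad1, magGrad2, perpGrad, ← Complex.normSq_eq_norm_sq,
      Complex.normSq_apply, Complex.add_re, Complex.add_im, Complex.sub_re, Complex.sub_im,
      Complex.mul_re, Complex.mul_im, Complex.ofReal_re, Complex.ofReal_im, Complex.I_re,
      Complex.I_im]
    simp only [pd1, pd2, ha, hb, ra, rb]
    ring
  have hz : ∫ x, (‖magGrad1 h ψ u x‖ ^ 2 + ‖magGrad2 h ψ u x‖ ^ 2 - h * (lap ψ x * ‖u x‖ ^ 2)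
      - ‖magGrad1 h ψ u x + Complex.I * magGrad2 h ψ u x‖ ^ 2) = 0 := by
    simp_rw [point]
    rw [integral_add, integral_fderiv_apply_eq_zero dG1 cG1, integral_fderiv_apply_eq_zero dG2 cG2,
      add_zero]
    · exact ((dG1.continuous_fderiv one_ne_zero).clm_apply
        continuous_const).integrable_of_hasCompactSupport (cG1.fderiv_apply (𝕜 := ℝ) _)
    · exact ((dG2.continuous_fderiv one_ne_zero).clm_apply
        continuous_const).integrable_of_hasCompactSupport (cG2.fderiv_apply (𝕜 := ℝ) _)
  have iAB : Integrable fun x =>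
      ‖magGrad1 h ψ u x‖ ^ 2 + ‖magGrad2 h ψ u x‖ ^ 2 - h * (lap ψ x * ‖u x‖ ^ 2) :=
    iA.sub (iB.const_mul h)
  rw [integral_sub iAB iC, integral_sub iA (iB.const_mul h),
    integral_const_mul] at hz
  linarith

theorem magGrad_add_exp_mul {h : ℝ} (hh : h ≠ 0) {ψ : ℝ × ℝ → ℝ} {v : ℝ × ℝ → ℂ} {x : ℝ × ℝ}
    (hψ : DifferentiableAt ℝ ψ x) (hv : DifferentiableAt ℝ v x) :
    magGrad1 h ψ (fun y => (Real.exp (-ψ y / h) : ℂ) * v y) x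
      + Complex.I * magGrad2 h ψ (fun y => (Real.exp (-ψ y / h) : ℂ) * v y) x
      = (Real.exp (-ψ x / h) : ℂ) * h * (pd1 v x + Complex.I * pd2 v x) := by
  have he : HasFDerivAt (fun y => (Real.exp (-ψ y / h) : ℂ))
      (Complex.ofRealCLM.comp (Real.exp (-ψ x / h) • ((h⁻¹ : ℝ) • -fderiv ℝ ψ x))) x := by
    have h1 : HasFDerivAt (fun y => -ψ y / h) ((h⁻¹ : ℝ) • -fderiv ℝ ψ x) x := by
      simpa [div_eq_mul_inv] using hψ.hasFDerivAt.neg.mul_const h⁻¹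
    exact Complex.ofRealCLM.hasFDerivAt.comp x h1.exp
  have hm := (he.mul hv.hasFDerivAt).fderiv
  have hd : ∀ w, fderiv ℝ (fun y => (Real.exp (-ψ y / h) : ℂ) * v y) x w
      = (Real.exp (-ψ x / h) : ℂ) * (fderiv ℝ v x w - (h : ℂ)⁻¹ * (fderiv ℝ ψ x w : ℂ) * v x) := by
    intro w
    have := congrArg (fun L => L w) hm
    refine this.trans ?_
    simp
    ring
  have hh' : (h : ℂ) ≠ 0 := by exact_mod_cast hh
  simp only [magGrad1, magGrad2, perpGrad, pd1, pd2, hd]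
  push_cast
  field_simp
  linear_combination (-(v x) * (fderiv ℝ ψ x (1, 0) : ℂ)) * Complex.I_sq

theorem integral_dbar_sq_eq {v : ℝ × ℝ → ℂ} (hv : ContDiff ℝ 2 v) (hc : HasCompactSupport v) :
    ∫ x, ‖pd1 v x + Complex.I * pd2 v x‖ ^ 2 = ∫ x, (‖pd1 v x‖ ^ 2 + ‖pd2 v x‖ ^ 2) := by
  have h0 := integral_magGrad_sq_sub_lap_eq (h := 1) (ψ := fun _ => 0) contDiff_const hv hc
  have z1 : pd1 (fun _ : ℝ × ℝ => (0 : ℝ)) = fun _ => 0 := by ext; simp [pd1]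
  have z2 : pd2 (fun _ : ℝ × ℝ => (0 : ℝ)) = fun _ => 0 := by ext; simp [pd2]
  simpa [magGrad1, magGrad2, perpGrad, lap, z1, z2] using h0.symm

/-- The Poincaré inequality in a strip. -/
theorem integral_norm_sq_le_pd1 {v : ℝ × ℝ → ℂ} (hv : ContDiff ℝ 2 v) (hc : HasCompactSupport v)
    {R : ℝ} (hR : ∀ x, v x ≠ 0 → |x.1| ≤ R) :
    ∫ x, ‖v x‖ ^ 2 ≤ 4 * R ^ 2 * ∫ x, ‖pd1 v x‖ ^ 2 := by
  set a : ℝ × ℝ → ℝ := fun x => (v x).re with ha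
  set b : ℝ × ℝ → ℝ := fun x => (v x).im with hb
  have hda1 : ContDiff ℝ 1 a := (Complex.reCLM.contDiff.comp hv).of_le (by norm_num)
  have hdb1 : ContDiff ℝ 1 b := (Complex.imCLM.contDiff.comp hv).of_le (by norm_num)
  have hac : HasCompactSupport a := hc.comp_left (g := Complex.re) rfl
  have hbc : HasCompactSupport b := hc.comp_left (g := Complex.im) rfl
  have v1 : ContDiff ℝ 1 (pd1 v) := hv.fderiv_apply_const _
  set F : ℝ × ℝ → ℝ := fun x => a x * (x.1 * a x) + b x * (x.1 * b x) with hF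
  have dF : ContDiff ℝ 1 F := by fun_prop
  have cF : HasCompactSupport F := hac.mul_right.add hbc.mul_right
  have i0 : Integrable fun x => ‖v x‖ ^ 2 :=
    Continuous.integrable_of_hasCompactSupport (by have := hv.continuous; fun_prop)
      (hc.comp_left (g := fun z => ‖z‖ ^ 2) (by simp))
  have i1 : Integrable fun x => ‖pd1 v x‖ ^ 2 :=
    Continuous.integrable_of_hasCompactSupport (by have := v1.continuous; fun_prop)
      ((hc.fderiv_apply (𝕜 := ℝ) _).comp_left (g := fun z => ‖z‖ ^ 2) (by simp))
  have iF : Integrable fun x => fderiv ℝ F x (1, 0) :=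
    ((dF.continuous_fderiv one_ne_zero).clm_apply
      continuous_const).integrable_of_hasCompactSupport (cF.fderiv_apply (𝕜 := ℝ) _)
  have point : ∀ x, ‖v x‖ ^ 2
      ≤ fderiv ℝ F x (1, 0) + (2⁻¹ * ‖v x‖ ^ 2 + 2 * R ^ 2 * ‖pd1 v x‖ ^ 2) := by
    intro x
    have fa := (hda1.differentiable one_ne_zero x).hasFDerivAt
    have fb := (hdb1.differentiable one_ne_zero x).hasFDerivAt
    have fx : HasFDerivAt (fun y : ℝ × ℝ => y.1) (ContinuousLinearMap.fst ℝ ℝ ℝ) x :=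
      hasFDerivAt_fst
    have hvd : DifferentiableAt ℝ v x := hv.differentiable (by norm_num) x
    have e1 : fderiv ℝ F x = _ := ((fa.mul (fx.mul fa)).add (fb.mul (fx.mul fb))).fderiv
    have e2 : fderiv ℝ F x (1, 0) = ‖v x‖ ^ 2
        + 2 * x.1 * ((v x).re * (pd1 v x).re + (v x).im * (pd1 v x).im) := by
      rw [e1]
      simp only [add_apply, smul_apply, smul_eq_mul, Pi.mul_apply, ha, hb, fderiv_re_apply hvd,
        fderiv_im_apply hvd, ContinuousLinearMap.coe_fst', ← Complex.normSq_eq_norm_sq,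
        Complex.normSq_apply, pd1]
      ring
    rw [e2]
    by_cases h0 : v x = 0
    · simp only [h0, norm_zero, Complex.zero_re, Complex.zero_im]
      have : 0 ≤ 2 * R ^ 2 * ‖pd1 v x‖ ^ 2 := by positivity
      linarith
    · have hx : x.1 ^ 2 ≤ R ^ 2 := sq_le_sq' (abs_le.1 (hR x h0)).1 (abs_le.1 (hR x h0)).2
      have h3 : x.1 ^ 2 * ‖pd1 v x‖ ^ 2 ≤ R ^ 2 * ‖pd1 v x‖ ^ 2 := by gcongr
      simp only [← Complex.normSq_eq_norm_sq, Complex.normSq_apply] at h3 ⊢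
      nlinarith [sq_nonneg ((v x).re + 2 * x.1 * (pd1 v x).re),
        sq_nonneg ((v x).im + 2 * x.1 * (pd1 v x).im)]
  have iE : Integrable fun x => 2⁻¹ * ‖v x‖ ^ 2 + 2 * R ^ 2 * ‖pd1 v x‖ ^ 2 :=
    (i0.const_mul 2⁻¹).add (i1.const_mul (2 * R ^ 2))
  have hle := integral_mono i0 (iF.add iE) point
  simp only [Pi.add_apply] at hle
  rw [integral_add iF iE, integral_fderiv_apply_eq_zero dF cF, integral_add (i0.const_mul 2⁻¹)
    (i1.const_mul (2 * R ^ 2)), integral_const_mul, integral_const_mul] at hle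
  linarith

open scoped Manifold in
theorem exists_smooth_cutoff {Ω K : Set (ℝ × ℝ)} (hΩ : IsOpen Ω) (hK : IsCompact K)
    (hKΩ : K ⊆ Ω) :
    ∃ χ : ℝ × ℝ → ℝ, ContDiff ℝ (⊤ : ℕ∞) χ ∧ HasCompactSupport χ ∧ tsupport χ ⊆ Ω ∧
      ∀ᶠ x in 𝓝ˢ K, χ x = 1 := by
  obtain ⟨L, hL, hKL, hLΩ⟩ := exists_compact_between hK hΩ hKΩ
  obtain ⟨χ, h1, h0, -⟩ := exists_contMDiffMap_one_nhds_of_subset_interior (n := (⊤ : ℕ∞))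
    𝓘(ℝ, ℝ × ℝ) hK.isClosed hKL
  have hs : tsupport χ ⊆ L := closure_minimal
    (fun x hx => by_contra fun hxL => hx (h0 x hxL)) hL.isClosed
  exact ⟨χ, χ.contMDiff.contDiff, hL.of_isClosed_subset (isClosed_tsupport _) hs,
    hs.trans hLΩ, h1⟩

theorem exists_contDiff_extension {Ω K : Set (ℝ × ℝ)} (hΩ : IsOpen Ω) (hK : IsCompact K)
    (hKΩ : K ⊆ Ω) {ψ : ℝ × ℝ → ℝ} (hψ : ContDiffOn ℝ 2 ψ Ω) :
    ∃ ψ' : ℝ × ℝ → ℝ, ContDiff ℝ 2 ψ' ∧ ∀ x ∈ K, ψ' =ᶠ[𝓝 x] ψ := by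
  obtain ⟨χ, hχ, -, hsupp, h1⟩ := exists_smooth_cutoff hΩ hK hKΩ
  refine ⟨fun x => χ x * ψ x, contDiff_iff_contDiffAt.2 fun x => ?_, fun x hx => ?_⟩
  · by_cases hx : x ∈ tsupport χ
    · exact ((contDiff_infty.1 hχ 2).contDiffAt).mul
        (hψ.contDiffAt (hΩ.mem_nhds (hsupp hx)))
    · refine (contDiffAt_const (c := (0 : ℝ))).congr_of_eventuallyEq ?_
      filter_upwards [(isClosed_tsupport χ).isOpen_compl.mem_nhds hx] with y hy
      simp [image_eq_zero_of_notMem_tsupport hy]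
  · filter_upwards [h1.filter_mono (nhds_le_nhdsSet hx)] with y hy
    simp [hy]

open scoped Convolution in
theorem ContDiffBump.norm_normed_convolution_le {E : Type*} [NormedAddCommGroup E]
    [NormedSpace ℝ E] [CompleteSpace E] (φ : ContDiffBump (0 : ℝ × ℝ)) {g : ℝ × ℝ → E}
    (hg : Continuous g) {M : ℝ} (hM : ∀ x, ‖g x‖ ≤ M) (x : ℝ × ℝ) :
    ‖(φ.normed volume ⋆[ContinuousLinearMap.lsmul ℝ ℝ, volume] g : ℝ × ℝ → E) x‖ ≤ 3 * M := by
  have h1 := φ.dist_normed_convolution_le (μ := (volume : Measure (ℝ × ℝ))) (x₀ := x)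
    (ε := 2 * M) hg.aestronglyMeasurable fun y _ => by
      rw [dist_eq_norm]
      linarith [norm_sub_le (g y) (g x), hM y, hM x]
  rw [dist_eq_norm] at h1
  have h2 := norm_le_norm_add_norm_sub'
    ((φ.normed volume ⋆[ContinuousLinearMap.lsmul ℝ ℝ, volume] g : ℝ × ℝ → E) x) (g x)
  linarith [hM x]

open scoped Convolution in
/-- Mollification of a compactly supported `C¹` function, with uniform `C¹` bounds. -/
theorem exists_smooth_approximation {u : ℝ × ℝ → ℂ} (hu : ContDiff ℝ 1 u)
    (hc : HasCompactSupport u) {Ω : Set (ℝ × ℝ)} (hΩ : IsOpen Ω) (hs : tsupport u ⊆ Ω) :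
    ∃ (K : Set (ℝ × ℝ)) (w : ℕ → ℝ × ℝ → ℂ) (M M' : ℝ), IsCompact K ∧ K ⊆ Ω ∧ tsupport u ⊆ K ∧
      (∀ n, ContDiff ℝ (⊤ : ℕ∞) (w n)) ∧ (∀ n, tsupport (w n) ⊆ K) ∧
      (∀ n x, ‖w n x‖ ≤ M) ∧ (∀ n x, ‖fderiv ℝ (w n) x‖ ≤ M') ∧
      (∀ x, Tendsto (fun n => w n x) atTop (𝓝 (u x))) ∧
      ∀ x, Tendsto (fun n => fderiv ℝ (w n) x) atTop (𝓝 (fderiv ℝ u x)) := by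
  obtain ⟨δ, hδ, hδΩ⟩ := hc.isCompact.exists_cthickening_subset_open hΩ hs
  obtain ⟨M, hM⟩ := hc.exists_bound_of_continuous hu.continuous
  have hcf := hu.continuous_fderiv one_ne_zero
  obtain ⟨M', hM'⟩ := (hc.fderiv (𝕜 := ℝ)).exists_bound_of_continuous hcf
  let φ : ℕ → ContDiffBump (0 : ℝ × ℝ) := fun n =>
    ⟨δ / (n + 1) / 2, δ / (n + 1), by positivity, half_lt_self (by positivity)⟩
  have hφ0 : Tendsto (fun n => (φ n).rOut) atTop (𝓝 0) := by
    have := (tendsto_one_div_add_atTop_nhds_zero_nat (𝕜 := ℝ)).const_mul δ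
    simpa [φ, div_eq_mul_inv] using this
  have hφδ : ∀ n, (φ n).rOut ≤ δ := fun n => div_le_self hδ.le (by simp)
  have hd : ∀ n, fderiv ℝ ((φ n).normed volume ⋆[ContinuousLinearMap.lsmul ℝ ℝ, volume] u)
      = ((φ n).normed volume ⋆[ContinuousLinearMap.lsmul ℝ ℝ, volume] fderiv ℝ u) := by
    intro n
    ext1 x
    rw [(hc.hasFDerivAt_convolution_right (ContinuousLinearMap.lsmul ℝ ℝ)
      ((φ n).integrable_normed (μ := volume)).locallyIntegrable hu x).fderiv]
    rfl
  refine ⟨Metric.cthickening δ (tsupport u),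
    fun n => (φ n).normed volume ⋆[ContinuousLinearMap.lsmul ℝ ℝ, volume] u, 3 * M, 3 * M',
    hc.isCompact.cthickening, hδΩ, Metric.self_subset_cthickening _, fun n => ?_, fun n => ?_,
    fun n x => ?_, fun n x => ?_, fun x => ?_, fun x => ?_⟩
  · exact (φ n).hasCompactSupport_normed.contDiff_convolution_left _ (φ n).contDiff_normed
      hu.continuous.locallyIntegrable
  · refine closure_minimal ((support_convolution_subset _).trans ?_) Metric.isClosed_cthickening
    rintro _ ⟨a, ha, b, hb, rfl⟩
    rw [(φ n).support_normed_eq, mem_ball_zero_iff] at ha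
    refine Metric.mem_cthickening_of_dist_le _ b _ _ (subset_closure hb) ?_
    simpa [dist_eq_norm] using ha.le.trans (hφδ n)
  · exact (φ n).norm_normed_convolution_le hu.continuous hM x
  · rw [hd]
    exact (φ n).norm_normed_convolution_le hcf hM' x
  · exact ContDiffBump.convolution_tendsto_right_of_continuous hφ0 hu.continuous x
  · simp_rw [hd]
    exact ContDiffBump.convolution_tendsto_right_of_continuous hφ0 hcf x

theorem pauliRayleigh_neg_one_eq {Ω K : Set (ℝ × ℝ)} {B ψ ψ' : ℝ × ℝ → ℝ}
    (hψ : IsScalarPotential Ω B ψ) (hKΩ : K ⊆ Ω) (hψ' : ContDiff ℝ 2 ψ')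
    (heq : ∀ x ∈ K, ψ' =ᶠ[𝓝 x] ψ) {u : ℝ × ℝ → ℂ} (hu : ContDiff ℝ 2 u)
    (hc : HasCompactSupport u) (hs : tsupport u ⊆ K) (h : ℝ) :
    pauliRayleigh (-1) h (perpGrad ψ) B Ω u
      = (∫ x, ‖magGrad1 h ψ' u x + Complex.I * magGrad2 h ψ' u x‖ ^ 2) / ∫ x, ‖u x‖ ^ 2 := by
  have hu0 : ∀ x ∉ K, u x = 0 := fun x hx => image_eq_zero_of_notMem_tsupport fun h => hx (hs h)
  have hdu0 : ∀ x ∉ K, fderiv ℝ u x = 0 := fun x hx => by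
    by_contra h0
    exact hx (hs (support_fderiv_subset ℝ h0))
  have hA : ∀ x ∈ K, perpGrad ψ x = perpGrad ψ' x := fun x hx => by
    simp [perpGrad, pd1, pd2, (heq x hx).fderiv_eq]
  have hB : ∀ x ∈ K, B x = lap ψ' x := fun x hx => by
    rw [← hψ.lap_eq x (hKΩ hx)]
    have e1 : pd1 ψ' =ᶠ[𝓝 x] pd1 ψ := by
      filter_upwards [(heq x hx).fderiv (𝕜 := ℝ)] with y hy
      simp [pd1, hy]
    have e2 : pd2 ψ' =ᶠ[𝓝 x] pd2 ψ := by
      filter_upwards [(heq x hx).fderiv (𝕜 := ℝ)] with y hy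
      simp [pd2, hy]
    have d1 : pd1 (pd1 ψ') x = pd1 (pd1 ψ) x := by
      rw [pd1, e1.fderiv_eq, ← pd1]
    have d2 : pd2 (pd2 ψ') x = pd2 (pd2 ψ) x := by
      rw [pd2, e2.fderiv_eq, ← pd2]
    rw [lap, lap, d1, d2]
  rw [← integral_magGrad_sq_sub_lap_eq hψ' hu hc, pauliRayleigh,
    setIntegral_eq_integral_of_forall_compl_eq_zero,
    setIntegral_eq_integral_of_forall_compl_eq_zero,
    setIntegral_eq_integral_of_forall_compl_eq_zero]
  · congr 1
    rw [neg_one_mul, ← sub_eq_add_neg]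
    congr 2
    · funext x
      by_cases hx : x ∈ K
      · simp [magGrad1, magGrad2, hA x hx]
      · simp [magGrad1, magGrad2, pd1, pd2, hu0 x hx, hdu0 x hx]
    · congr 1
      funext x
      by_cases hx : x ∈ K
      · simp [hB x hx]
      · simp [hu0 x hx]
  · intro x hx
    simp [hu0 x fun h => hx (hKΩ h)]
  · intro x hx
    simp [hu0 x fun h => hx (hKΩ h)]
  · intro x hx
    simp [pd1, pd2, hu0 x fun h => hx (hKΩ h), hdu0 x fun h => hx (hKΩ h)]

theorem integral_norm_sq_pos {u : ℝ × ℝ → ℂ} (hu : Continuous u) (hc : HasCompactSupport u)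
    (h0 : u ≠ 0) : 0 < ∫ x, ‖u x‖ ^ 2 := by
  obtain ⟨x, hx⟩ := Function.ne_iff.1 h0
  have hcont : Continuous fun x => ‖u x‖ ^ 2 := by fun_prop
  exact hcont.integral_pos_of_hasCompactSupport_nonneg_nonzero
    (hc.comp_left (g := fun z => ‖z‖ ^ 2) (by simp)) (fun x => by positivity)
    (x := x) (by simpa using hx)

theorem lambdaMinusD_le_pauliRayleigh {Ω : Set (ℝ × ℝ)} {B ψ : ℝ × ℝ → ℝ} (hΩ : IsOpen Ω)
    (hψ : IsScalarPotential Ω B ψ) {u : ℝ × ℝ → ℂ} (hu : ContDiff ℝ 2 u)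
    (hc : HasCompactSupport u) (hs : tsupport u ⊆ Ω) (h0 : u ≠ 0) (h : ℝ) :
    lambdaMinusD h (perpGrad ψ) B Ω ≤ pauliRayleigh (-1) h (perpGrad ψ) B Ω u := by
  obtain ⟨K, w, M, M', hK, hKΩ, huK, hw, hwK, hwM, hwM', hlim, hlim'⟩ :=
    exists_smooth_approximation (hu.of_le (by norm_num)) hc hΩ hs
  obtain ⟨ψ', hψ', heq⟩ := exists_contDiff_extension hΩ hK hKΩ hψ.c2
  have hwc : ∀ n, HasCompactSupport (w n) := fun n =>
    hK.of_isClosed_subset (isClosed_tsupport _) (hwK n)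
  have hw2 : ∀ n, ContDiff ℝ 2 (w n) := fun n => contDiff_infty.1 (hw n) 2
  have p1 : Continuous (pd1 ψ') := (hψ'.fderiv_apply_const _).continuous
  have p2 : Continuous (pd2 ψ') := (hψ'.fderiv_apply_const _).continuous
  obtain ⟨C1, hC1⟩ := hK.exists_bound_of_continuousOn p1.continuousOn
  obtain ⟨C2, hC2⟩ := hK.exists_bound_of_continuousOn p2.continuousOn
  have hnum : Tendsto
      (fun n => ∫ x, ‖magGrad1 h ψ' (w n) x + Complex.I * magGrad2 h ψ' (w n) x‖ ^ 2) atTop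
      (𝓝 (∫ x, ‖magGrad1 h ψ' u x + Complex.I * magGrad2 h ψ' u x‖ ^ 2)) := by
    refine tendsto_integral_of_dominated_convergence
      (K.indicator fun _ => (|h| * M' + C2 * M + (|h| * M' + C1 * M)) ^ 2) (fun n => ?_) ?_
      (fun n => Eventually.of_forall fun x => ?_) (Eventually.of_forall fun x => ?_)
    · have q1 : Continuous (pd1 (w n)) := ((hw2 n).fderiv_apply_const _).continuous
      have q2 : Continuous (pd2 (w n)) := ((hw2 n).fderiv_apply_const _).continuous
      have q0 := (hw2 n).continuous
      refine Continuous.aestronglyMeasurable ?_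
      unfold magGrad1 magGrad2 perpGrad
      fun_prop
    · exact (integrable_indicator_iff hK.measurableSet).2
        (integrableOn_const hK.measure_lt_top.ne)
    · by_cases hx : x ∈ K
      · rw [indicator_of_mem hx, Real.norm_of_nonneg (by positivity)]
        have hM0 : 0 ≤ M := (norm_nonneg _).trans (hwM n x)
        have b1 : ‖pd1 (w n) x‖ ≤ M' :=
          ((fderiv ℝ (w n) x).le_of_opNorm_le (hwM' n x) _).trans (by simp [Prod.norm_def])
        have b2 : ‖pd2 (w n) x‖ ≤ M' :=
          ((fderiv ℝ (w n) x).le_of_opNorm_le (hwM' n x) _).trans (by simp [Prod.norm_def])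
        have m1 : ‖magGrad1 h ψ' (w n) x‖ ≤ |h| * M' + C2 * M := by
          refine (norm_sub_le _ _).trans ?_
          simp only [norm_mul, Complex.norm_real, Complex.norm_I, one_mul, perpGrad, norm_neg,
            Real.norm_eq_abs h]
          gcongr
          exacts [(norm_nonneg _).trans (hC2 x hx), hC2 x hx, hwM n x]
        have m2 : ‖magGrad2 h ψ' (w n) x‖ ≤ |h| * M' + C1 * M := by
          refine (norm_sub_le _ _).trans ?_
          simp only [norm_mul, Complex.norm_real, Complex.norm_I, one_mul, perpGrad,
            Real.norm_eq_abs h]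
          gcongr
          exacts [(norm_nonneg _).trans (hC1 x hx), hC1 x hx, hwM n x]
        gcongr
        refine (norm_add_le _ _).trans ?_
        rw [norm_mul, Complex.norm_I, one_mul]
        exact add_le_add m1 m2
      · have z1 : w n x = 0 := image_eq_zero_of_notMem_tsupport fun h => hx (hwK n h)
        have z2 : fderiv ℝ (w n) x = 0 := by
          by_contra h0
          exact hx (hwK n (support_fderiv_subset ℝ h0))
        simp [hx, magGrad1, magGrad2, pd1, pd2, z1, z2]
    · have l1 : Tendsto (fun n => pd1 (w n) x) atTop (𝓝 (pd1 u x)) :=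
        ((ContinuousLinearMap.apply ℝ ℂ ((1, 0) : ℝ × ℝ)).continuous.tendsto _).comp (hlim' x)
      have l2 : Tendsto (fun n => pd2 (w n) x) atTop (𝓝 (pd2 u x)) :=
        ((ContinuousLinearMap.apply ℝ ℂ ((0, 1) : ℝ × ℝ)).continuous.tendsto _).comp (hlim' x)
      exact (((l1.const_mul _).sub ((hlim x).const_mul _)).add
        (((l2.const_mul _).sub ((hlim x).const_mul _)).const_mul _)).norm.pow 2
  have hden : Tendsto (fun n => ∫ x, ‖w n x‖ ^ 2) atTop (𝓝 (∫ x, ‖u x‖ ^ 2)) := by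
    refine tendsto_integral_of_dominated_convergence (K.indicator fun _ => M ^ 2) (fun n => ?_) ?_
      (fun n => Eventually.of_forall fun x => ?_)
      (Eventually.of_forall fun x => (hlim x).norm.pow 2)
    · have q0 := (hw2 n).continuous
      exact Continuous.aestronglyMeasurable (by fun_prop)
    · exact (integrable_indicator_iff hK.measurableSet).2
        (integrableOn_const hK.measure_lt_top.ne)
    · by_cases hx : x ∈ K
      · rw [indicator_of_mem hx, Real.norm_of_nonneg (by positivity)]
        gcongr
        exact hwM n x
      · have z1 : w n x = 0 := image_eq_zero_of_notMem_tsupport fun h => hx (hwK n h)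
        simp [hx, z1]
  have hpos := integral_norm_sq_pos hu.continuous hc h0
  rw [pauliRayleigh_neg_one_eq hψ hKΩ hψ' heq hu hc huK]
  refine ge_of_tendsto (hnum.div hden hpos.ne') ?_
  filter_upwards [hden.eventually (lt_mem_nhds hpos)] with n hn
  rw [Pi.div_apply, ← pauliRayleigh_neg_one_eq hψ hKΩ hψ' heq (hw2 n) (hwc n) (hwK n)]
  refine csInf_le ⟨0, ?_⟩ ⟨w n, ⟨hw n, hwc n, (hwK n).trans hKΩ, ?_⟩, rfl⟩
  · rintro _ ⟨v, ⟨hv, hvc, hvs, -⟩, rfl⟩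
    obtain ⟨ψ'', hψ'', heq'⟩ := exists_contDiff_extension hΩ hvc.isCompact hvs hψ.c2
    rw [pauliRayleigh_neg_one_eq hψ hvs hψ'' heq' (contDiff_infty.1 hv 2) hvc subset_rfl]
    positivity
  · rintro hz
    simp [hz] at hn

/-- Conjugating by `exp (ψ / h)` turns the Pauli quotient into a weighted `∂̄`-quotient. -/
theorem pauliRayleigh_neg_one_exp_mul_eq {Ω : Set (ℝ × ℝ)} {B ψ ψ' : ℝ × ℝ → ℝ}
    (hψ : IsScalarPotential Ω B ψ) {v : ℝ × ℝ → ℂ} (hv : ContDiff ℝ 2 v)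
    (hc : HasCompactSupport v) (hs : tsupport v ⊆ Ω) (hψ' : ContDiff ℝ 2 ψ')
    (heq : ∀ x ∈ tsupport v, ψ' =ᶠ[𝓝 x] ψ) {h : ℝ} (hh : h ≠ 0) :
    pauliRayleigh (-1) h (perpGrad ψ) B Ω (fun x => (Real.exp (-ψ' x / h) : ℂ) * v x)
      = (∫ x, h ^ 2 * (Real.exp (-2 * ψ' x / h) * ‖pd1 v x + Complex.I * pd2 v x‖ ^ 2))
        / ∫ x, Real.exp (-2 * ψ' x / h) * ‖v x‖ ^ 2 := by
  have he : ContDiff ℝ 2 fun x => (Real.exp (-ψ' x / h) : ℂ) :=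
    Complex.ofRealCLM.contDiff.comp (hψ'.neg.div_const h).exp
  have hsq : ∀ x, Real.exp (-ψ' x / h) ^ 2 = Real.exp (-2 * ψ' x / h) := fun x => by
    rw [← Real.exp_nat_mul]
    congr 1
    push_cast
    ring
  rw [pauliRayleigh_neg_one_eq hψ hs hψ' heq (he.mul hv) hc.mul_left
    (closure_mono (Function.support_mul_subset_right _ _))]
  congr 2 <;> funext x
  · rw [magGrad_add_exp_mul hh (hψ'.differentiable (by norm_num) x)
      (hv.differentiable (by norm_num) x), norm_mul, norm_mul, Complex.norm_real,
      Complex.norm_real, mul_pow, mul_pow, Real.norm_eq_abs, Real.norm_eq_abs, sq_abs, sq_abs, hsq]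
    ring
  · rw [norm_mul, Complex.norm_real, mul_pow, Real.norm_eq_abs, sq_abs, hsq]

theorem continuous_dbar {v : ℝ × ℝ → ℂ} (hv : ContDiff ℝ 2 v) :
    Continuous fun x => pd1 v x + Complex.I * pd2 v x := by
  have q1 : Continuous (pd1 v) := (hv.fderiv_apply_const _).continuous
  have q2 : Continuous (pd2 v) := (hv.fderiv_apply_const _).continuous
  fun_prop

theorem hasCompactSupport_dbar {v : ℝ × ℝ → ℂ} (hc : HasCompactSupport v) :
    HasCompactSupport fun x => pd1 v x + Complex.I * pd2 v x :=
  HasCompactSupport.add (hc.fderiv_apply (𝕜 := ℝ) _) (hc.fderiv_apply (𝕜 := ℝ) _).mul_left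

theorem le_pauliRayleigh_neg_one {Ω : Set (ℝ × ℝ)} {B ψ : ℝ × ℝ → ℝ} (hΩ : IsOpen Ω)
    (hψ : IsScalarPotential Ω B ψ) {m R : ℝ} (hR0 : 0 < R) (hm : ∀ x ∈ Ω, m ≤ ψ x)
    (hneg : ∀ x ∈ Ω, ψ x ≤ 0) (hR : ∀ x ∈ Ω, |x.1| ≤ R) {u : ℝ × ℝ → ℂ} (hu : IsTestFun Ω u)
    {h : ℝ} (hh : 0 < h) :
    (4 * R ^ 2)⁻¹ * h ^ 2 * Real.exp (2 * m / h) ≤ pauliRayleigh (-1) h (perpGrad ψ) B Ω u := by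
  obtain ⟨hud, hc, hs, hu0⟩ := hu
  obtain ⟨ψ', hψ', heq⟩ := exists_contDiff_extension hΩ hc.isCompact hs hψ.c2
  set v : ℝ × ℝ → ℂ := fun x => (Real.exp (ψ' x / h) : ℂ) * u x with hvdef
  have he : ContDiff ℝ 2 fun x => (Real.exp (ψ' x / h) : ℂ) :=
    Complex.ofRealCLM.contDiff.comp (hψ'.div_const h).exp
  have hv : ContDiff ℝ 2 v := he.mul (contDiff_infty.1 hud 2)
  have hvc : HasCompactSupport v := hc.mul_left
  have hvs : tsupport v ⊆ tsupport u := closure_mono (Function.support_mul_subset_right _ _)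
  have huv : u = fun x => (Real.exp (-ψ' x / h) : ℂ) * v x := by
    funext x
    rw [hvdef, ← mul_assoc, ← Complex.ofReal_mul, ← Real.exp_add, neg_div, neg_add_cancel]
    simp
  have hv0 : v ≠ 0 := fun h0 => hu0 (by rw [huv, h0]; funext x; simp)
  have hψ'c : Continuous ψ' := hψ'.continuous
  have hvcont := hv.continuous
  have dcont := continuous_dbar hv
  have dcomp := hasCompactSupport_dbar hvc
  have hdsupp : ∀ x ∉ tsupport u, pd1 v x + Complex.I * pd2 v x = 0 := fun x hx => by
    have : fderiv ℝ v x = 0 := by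
      by_contra h0
      exact hx (hvs (support_fderiv_subset ℝ h0))
    simp [pd1, pd2, this]
  have hval : ∀ x ∈ tsupport u, m ≤ ψ' x ∧ ψ' x ≤ 0 := fun x hx => by
    rw [(heq x hx).eq_of_nhds]
    exact ⟨hm x (hs hx), hneg x (hs hx)⟩
  have i2 : Integrable fun x => ‖v x‖ ^ 2 :=
    Continuous.integrable_of_hasCompactSupport (by fun_prop)
      (hvc.comp_left (g := fun z => ‖z‖ ^ 2) (by simp))
  have i3 : Integrable fun x => Real.exp (-2 * ψ' x / h) * ‖v x‖ ^ 2 :=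
    Continuous.integrable_of_hasCompactSupport (by fun_prop)
      (hvc.comp_left (g := fun z => ‖z‖ ^ 2) (by simp)).mul_left
  have i4 : Integrable fun x => ‖pd1 v x + Complex.I * pd2 v x‖ ^ 2 :=
    Continuous.integrable_of_hasCompactSupport (by fun_prop)
      (dcomp.comp_left (g := fun z => ‖z‖ ^ 2) (by simp))
  have i5 : Integrable fun x =>
      Real.exp (-2 * ψ' x / h) * ‖pd1 v x + Complex.I * pd2 v x‖ ^ 2 :=
    Continuous.integrable_of_hasCompactSupport (by fun_prop)
      (dcomp.comp_left (g := fun z => ‖z‖ ^ 2) (by simp)).mul_left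
  have hnum : ∫ x, ‖v x‖ ^ 2 ≤ 4 * R ^ 2 *
      ∫ x, Real.exp (-2 * ψ' x / h) * ‖pd1 v x + Complex.I * pd2 v x‖ ^ 2 := by
    refine (integral_norm_sq_le_pd1 hv hvc fun x hx =>
      hR x (hs (hvs (subset_closure hx)))).trans ?_
    refine mul_le_mul_of_nonneg_left ?_ (by positivity)
    have q1 : Continuous (pd1 v) := (hv.fderiv_apply_const _).continuous
    have q2 : Continuous (pd2 v) := (hv.fderiv_apply_const _).continuous
    have c1 : HasCompactSupport (pd1 v) := hvc.fderiv_apply (𝕜 := ℝ) _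
    have c2 : HasCompactSupport (pd2 v) := hvc.fderiv_apply (𝕜 := ℝ) _
    have j1 : Integrable fun x => ‖pd1 v x‖ ^ 2 :=
      Continuous.integrable_of_hasCompactSupport (by fun_prop)
        (c1.comp_left (g := fun z => ‖z‖ ^ 2) (by simp))
    have j2 : Integrable fun x => ‖pd2 v x‖ ^ 2 :=
      Continuous.integrable_of_hasCompactSupport (by fun_prop)
        (c2.comp_left (g := fun z => ‖z‖ ^ 2) (by simp))
    calc ∫ x, ‖pd1 v x‖ ^ 2 ≤ ∫ x, (‖pd1 v x‖ ^ 2 + ‖pd2 v x‖ ^ 2) :=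
          integral_mono j1 (j1.add j2) fun x => le_add_of_nonneg_right (by positivity)
      _ = ∫ x, ‖pd1 v x + Complex.I * pd2 v x‖ ^ 2 := (integral_dbar_sq_eq hv hvc).symm
      _ ≤ _ := by
        refine integral_mono i4 i5 fun x => ?_
        by_cases hx : x ∈ tsupport u
        · refine le_mul_of_one_le_left (by positivity) (Real.one_le_exp ?_)
          have := (hval x hx).2
          exact div_nonneg (by linarith) hh.le
        · simp [hdsupp x hx]
  have hden : Real.exp (2 * m / h) * ∫ x, Real.exp (-2 * ψ' x / h) * ‖v x‖ ^ 2
      ≤ ∫ x, ‖v x‖ ^ 2 := by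
    rw [← integral_const_mul]
    refine integral_mono (i3.const_mul _) i2 fun x => ?_
    by_cases hx : x ∈ tsupport u
    · simp only
      rw [← mul_assoc, ← Real.exp_add]
      refine mul_le_of_le_one_left (by positivity) (Real.exp_le_one_iff.2 ?_)
      rw [← add_div]
      have := (hval x hx).1
      exact div_nonpos_of_nonpos_of_nonneg (by linarith) hh.le
    · simp [hvdef, image_eq_zero_of_notMem_tsupport hx]
  have hpos : 0 < ∫ x, Real.exp (-2 * ψ' x / h) * ‖v x‖ ^ 2 := by
    obtain ⟨x, hx⟩ := Function.ne_iff.1 hv0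
    have hcont : Continuous fun x => Real.exp (-2 * ψ' x / h) * ‖v x‖ ^ 2 := by fun_prop
    refine hcont.integral_pos_of_hasCompactSupport_nonneg_nonzero
      (hvc.comp_left (g := fun z => ‖z‖ ^ 2) (by simp)).mul_left (fun x => by positivity)
      (x := x) ?_
    have : ‖v x‖ ≠ 0 := norm_ne_zero_iff.2 hx
    positivity
  rw [huv, pauliRayleigh_neg_one_exp_mul_eq hψ hv hvc (hvs.trans hs) hψ'
    (fun x hx => heq x (hvs hx)) hh.ne', le_div_iff₀ hpos, integral_const_mul]
  calc _ = h ^ 2 * ((4 * R ^ 2)⁻¹ *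
        (Real.exp (2 * m / h) * ∫ x, Real.exp (-2 * ψ' x / h) * ‖v x‖ ^ 2)) := by ring
    _ ≤ _ := by
      refine mul_le_mul_of_nonneg_left ?_ (by positivity)
      rw [inv_mul_le_iff₀ (by positivity)]
      exact hden.trans hnum

theorem exists_isTestFun {Ω : Set (ℝ × ℝ)} (hΩ : IsOpen Ω) (hne : Ω.Nonempty) :
    ∃ u, IsTestFun Ω u := by
  obtain ⟨x, hx⟩ := hne
  obtain ⟨χ, hχ, hc, hs, h1⟩ := exists_smooth_cutoff hΩ isCompact_singleton
    (singleton_subset_iff.2 hx)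
  refine ⟨fun y => (χ y : ℂ), Complex.ofRealCLM.contDiff.comp hχ,
    hc.comp_left (g := fun t : ℝ => (t : ℂ)) (by simp), ?_, fun h0 => ?_⟩
  · refine (closure_mono fun y hy => ?_).trans hs
    simpa using hy
  · have := congrFun h0 x
    simp [h1.self_of_nhdsSet x rfl] at this

theorem le_lambdaMinusD {Ω : Set (ℝ × ℝ)} {B ψ : ℝ × ℝ → ℝ} (hΩ : IsOpen Ω) (hne : Ω.Nonempty)
    (hψ : IsScalarPotential Ω B ψ) {m R : ℝ} (hR0 : 0 < R) (hm : ∀ x ∈ Ω, m ≤ ψ x)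
    (hneg : ∀ x ∈ Ω, ψ x ≤ 0) (hR : ∀ x ∈ Ω, |x.1| ≤ R) {h : ℝ} (hh : 0 < h) :
    (4 * R ^ 2)⁻¹ * h ^ 2 * Real.exp (2 * m / h) ≤ lambdaMinusD h (perpGrad ψ) B Ω := by
  refine le_csInf ?_ ?_
  · obtain ⟨u, hu⟩ := exists_isTestFun hΩ hne
    exact ⟨_, u, hu, rfl⟩
  · rintro _ ⟨u, hu, rfl⟩
    exact le_pauliRayleigh_neg_one hΩ hψ hR0 hm hneg hR hu hh

theorem lambdaMinusD_le {Ω : Set (ℝ × ℝ)} {B ψ : ℝ × ℝ → ℝ} (hΩ : IsOpen Ω)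
    (hψ : IsScalarPotential Ω B ψ) {m ε : ℝ} (hK : IsCompact {x | x ∈ Ω ∧ ψ x ≤ -ε})
    (hmε : m + ε ≤ -ε) (hex : ∃ x ∈ Ω, ψ x < m + ε) :
    ∃ C > 0, ∀ h > 0,
      lambdaMinusD h (perpGrad ψ) B Ω ≤ C * h ^ 2 * Real.exp ((2 * m + 4 * ε) / h) := by
  obtain ⟨χ, hχ, hχc, hχs, hχ1⟩ := exists_smooth_cutoff hΩ hK fun x hx => hx.1
  have hχK : ∀ x ∈ Ω, ψ x ≤ -ε → χ =ᶠ[𝓝 x] fun _ => 1 := fun x hx hxε =>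
    hχ1.filter_mono (nhds_le_nhdsSet (s := {x | x ∈ Ω ∧ ψ x ≤ -ε}) ⟨hx, hxε⟩)
  obtain ⟨ψ', hψ', heq'⟩ := exists_contDiff_extension hΩ hχc.isCompact hχs hψ.c2
  have heqχ : ∀ x ∈ tsupport χ, ψ' x = ψ x := fun x hx => (heq' x hx).eq_of_nhds
  set v : ℝ × ℝ → ℂ := fun x => (χ x : ℂ) with hvdef
  have hv : ContDiff ℝ 2 v := Complex.ofRealCLM.contDiff.comp (contDiff_infty.1 hχ 2)
  have hvc : HasCompactSupport v := hχc.comp_left (g := fun t : ℝ => (t : ℂ)) (by simp)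
  have hvs : tsupport v ⊆ tsupport χ := closure_mono fun y hy => by simpa [hvdef] using hy
  set U : Set (ℝ × ℝ) := {x | x ∈ Ω ∧ ψ x < m + ε} with hU
  have hUo : IsOpen U := hψ.c2.continuousOn.isOpen_inter_preimage hΩ isOpen_Iio
  have hUK : U ⊆ {x | x ∈ Ω ∧ ψ x ≤ -ε} := fun x hx => ⟨hx.1, hx.2.le.trans hmε⟩
  have hUfin : volume U < ⊤ := (measure_mono hUK).trans_lt hK.measure_lt_top
  have hUpos : 0 < volume.real U := by
    obtain ⟨x, hx, hx'⟩ := hex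
    exact ENNReal.toReal_pos (hUo.measure_pos volume ⟨x, hx, hx'⟩).ne' hUfin.ne
  have hU1 : ∀ x ∈ U, χ x = 1 := fun x hx => (hχK x hx.1 (hUK hx).2).eq_of_nhds
  have hUχ : ∀ x ∈ U, ψ' x < m + ε := fun x hx => by
    rw [heqχ x (subset_closure (by simp [hU1 x hx]))]
    exact hx.2
  have dcont := continuous_dbar hv
  have dcomp := hasCompactSupport_dbar hvc
  set I := ∫ x, ‖pd1 v x + Complex.I * pd2 v x‖ ^ 2 with hI
  have hI0 : 0 ≤ I := integral_nonneg fun x => by positivity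
  refine ⟨(I + 1) / volume.real U, by positivity, fun h hh => ?_⟩
  have hψ'c : Continuous ψ' := hψ'.continuous
  have hvcont := hv.continuous
  have i3 : Integrable fun x => Real.exp (-2 * ψ' x / h) * ‖v x‖ ^ 2 :=
    Continuous.integrable_of_hasCompactSupport (by fun_prop)
      (hvc.comp_left (g := fun z => ‖z‖ ^ 2) (by simp)).mul_left
  have i4 : Integrable fun x => ‖pd1 v x + Complex.I * pd2 v x‖ ^ 2 :=
    Continuous.integrable_of_hasCompactSupport (by fun_prop)
      (dcomp.comp_left (g := fun z => ‖z‖ ^ 2) (by simp))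
  have i5 : Integrable fun x =>
      Real.exp (-2 * ψ' x / h) * ‖pd1 v x + Complex.I * pd2 v x‖ ^ 2 :=
    Continuous.integrable_of_hasCompactSupport (by fun_prop)
      (dcomp.comp_left (g := fun z => ‖z‖ ^ 2) (by simp)).mul_left
  have hnum : ∫ x, Real.exp (-2 * ψ' x / h) * ‖pd1 v x + Complex.I * pd2 v x‖ ^ 2
      ≤ Real.exp (2 * ε / h) * I := by
    rw [hI, ← integral_const_mul]
    refine integral_mono i5 (i4.const_mul _) fun x => ?_
    by_cases hx : fderiv ℝ v x = 0
    · simp [pd1, pd2, hx]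
    · have hxχ : x ∈ tsupport χ := hvs (support_fderiv_subset ℝ hx)
      have hxε : -ε < ψ' x := by
        rw [heqχ x hxχ]
        by_contra! hle
        have : v =ᶠ[𝓝 x] fun _ => 1 := by
          filter_upwards [hχK x (hχs hxχ) hle] with y hy
          simp [hvdef, hy]
        exact hx (by rw [this.fderiv_eq]; simp)
      exact mul_le_mul_of_nonneg_right (Real.exp_le_exp.2
        (div_le_div_of_nonneg_right (by linarith) hh.le)) (by positivity)
  have hden : Real.exp (-2 * (m + ε) / h) * volume.real U
      ≤ ∫ x, Real.exp (-2 * ψ' x / h) * ‖v x‖ ^ 2 := by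
    have h1 : ∫ x in U, Real.exp (-2 * (m + ε) / h)
        ≤ ∫ x in U, Real.exp (-2 * ψ' x / h) * ‖v x‖ ^ 2 := by
      refine setIntegral_mono_on (integrableOn_const hUfin.ne) i3.integrableOn
        hUo.measurableSet fun x hx => ?_
      have hlt := hUχ x hx
      have hv1 : v x = 1 := by simp [hvdef, hU1 x hx]
      rw [hv1, norm_one, one_pow, mul_one]
      exact Real.exp_le_exp.2 (div_le_div_of_nonneg_right (by linarith) hh.le)
    rw [setIntegral_const, smul_eq_mul, mul_comm] at h1
    exact h1.trans (setIntegral_le_integral i3 (Eventually.of_forall fun x => by positivity))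
  have hu : ContDiff ℝ 2 fun x => (Real.exp (-ψ' x / h) : ℂ) * v x :=
    (Complex.ofRealCLM.contDiff.comp (hψ'.neg.div_const h).exp).mul hv
  have hu0 : (fun x => (Real.exp (-ψ' x / h) : ℂ) * v x) ≠ 0 := by
    obtain ⟨x, hx, hx'⟩ := hex
    intro h0
    have := congrFun h0 x
    simp [hvdef, hU1 x ⟨hx, hx'⟩] at this
  refine (lambdaMinusD_le_pauliRayleigh hΩ hψ hu hvc.mul_left
    ((closure_mono (Function.support_mul_subset_right _ _)).trans (hvs.trans hχs)) hu0 h).trans ?_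
  rw [pauliRayleigh_neg_one_exp_mul_eq hψ hv hvc (hvs.trans hχs) hψ'
    (fun x hx => heq' x (hvs hx)) hh.ne', integral_const_mul]
  calc _ ≤ h ^ 2 * (Real.exp (2 * ε / h) * (I + 1))
        / (Real.exp (-2 * (m + ε) / h) * volume.real U) := by
        gcongr
        exact hnum.trans (by gcongr; linarith)
    _ = _ := by
      have : Real.exp ((2 * m + 4 * ε) / h)
          = Real.exp (2 * ε / h) / Real.exp (-2 * (m + ε) / h) := by
        rw [← Real.exp_sub]
        congr 1
        ring
      rw [this]
      field_simp

theorem tendsto_mul_log_const_mul_sq {c : ℝ} (hc : 0 < c) :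
    Tendsto (fun h : ℝ => h * Real.log (c * h ^ 2)) (𝓝[>] 0) (𝓝 0) := by
  have h1 : Tendsto (fun h : ℝ => h) (𝓝[>] 0) (𝓝 0) :=
    tendsto_nhdsWithin_of_tendsto_nhds tendsto_id
  have h2 := (h1.mul_const (Real.log c)).add
    ((tendsto_log_mul_rpow_nhdsGT_zero one_pos).const_mul 2)
  simp only [zero_mul, mul_zero, add_zero, Real.rpow_one] at h2
  refine h2.congr' ?_
  filter_upwards [self_mem_nhdsWithin] with h hh
  have hh' : h ≠ 0 := ne_of_gt hh
  rw [Real.log_mul hc.ne' (by positivity), Real.log_pow]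
  push_cast
  ring

theorem tendsto_mul_log_of_exp_bounds {L : ℝ → ℝ} {m c δ : ℝ} (hc : 0 < c) (hδ : 0 < δ)
    (hlow : ∀ h > 0, c * h ^ 2 * Real.exp (2 * m / h) ≤ L h)
    (hup : ∀ ε > 0, ε ≤ δ → ∃ C > 0, ∀ h > 0,
      L h ≤ C * h ^ 2 * Real.exp ((2 * m + 4 * ε) / h)) :
    Tendsto (fun h => h * Real.log (L h)) (𝓝[>] 0) (𝓝 (2 * m)) := by
  have expand : ∀ {a b h : ℝ}, 0 < a → 0 < h →
      h * Real.log (a * h ^ 2 * Real.exp (b / h)) = h * Real.log (a * h ^ 2) + b := by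
    intro a b h ha hh
    rw [Real.log_mul (by positivity) (Real.exp_pos _).ne', Real.log_exp]
    field_simp
  refine tendsto_order.2 ⟨fun a ha => ?_, fun a ha => ?_⟩
  · have h1 := (tendsto_mul_log_const_mul_sq hc).add_const (2 * m)
    rw [zero_add] at h1
    filter_upwards [h1.eventually (lt_mem_nhds ha), self_mem_nhdsWithin] with h h2 hh
    replace hh : 0 < h := hh
    rw [← expand hc hh] at h2
    exact h2.trans_le (mul_le_mul_of_nonneg_left
      (Real.log_le_log (by positivity) (hlow h hh)) hh.le)
  · obtain ⟨C, hC, hCL⟩ := hup (min δ ((a - 2 * m) / 8)) (lt_min hδ (by linarith)) (min_le_left _ _)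
    have h1 := (tendsto_mul_log_const_mul_sq hC).add_const (2 * m + 4 * min δ ((a - 2 * m) / 8))
    rw [zero_add] at h1
    have ha' : 2 * m + 4 * min δ ((a - 2 * m) / 8) < a := by
      linarith [min_le_right δ ((a - 2 * m) / 8)]
    filter_upwards [h1.eventually (gt_mem_nhds ha'), self_mem_nhdsWithin] with h h2 hh
    replace hh : 0 < h := hh
    rw [← expand hC hh] at h2
    exact (mul_le_mul_of_nonneg_left (Real.log_le_log
      (lt_of_lt_of_le (by positivity) (hlow h hh)) (hCL h hh)) hh.le).trans_lt h2

/-- Theorem 2.5 / `th1.7`: if `ψ₀ < 0` in `Ω` then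
`lim_{h→0⁺} h·log λ₋^D(h,B,Ω) = 2·inf_Ω ψ₀`. -/
theorem pauli_lim_eq_of_psi_neg (Ω : Set (ℝ × ℝ)) (B ψ₀ : ℝ × ℝ → ℝ)
    (hR : AssumptionR Ω B) (hsc : SimplyConnectedSpace Ω)
    (hψ : IsScalarPotential Ω B ψ₀) (hneg : ∀ x ∈ Ω, ψ₀ x < 0) :
    Tendsto (fun h : ℝ => h * Real.log (lambdaMinusD h (perpGrad ψ₀) B Ω)) (𝓝[>] 0)
      (𝓝 (2 * sInf (ψ₀ '' Ω))) := by
  have hΩ := hR.isOpen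
  have hne : Ω.Nonempty :=
    nonempty_coe_sort.1 ((simply_connected_iff_unique_homotopic Ω).1 hsc).1
  have hcl : IsCompact (closure Ω) := hR.bounded.isCompact_closure
  obtain ⟨R, hRb⟩ := hR.bounded.exists_norm_le
  have hbdd : BddBelow (ψ₀ '' Ω) :=
    (hcl.bddBelow_image hψ.contOn).mono (image_mono subset_closure)
  have hlt : sInf (ψ₀ '' Ω) < 0 := by
    obtain ⟨x, hx⟩ := hne
    exact (csInf_le hbdd (mem_image_of_mem _ hx)).trans_lt (hneg x hx)
  refine tendsto_mul_log_of_exp_bounds (c := (4 * (max R 1) ^ 2)⁻¹) (δ := -sInf (ψ₀ '' Ω) / 2)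
    (by positivity) (by linarith) (fun h hh => ?_) (fun ε hε hεδ => ?_)
  · refine le_lambdaMinusD hΩ hne hψ (by positivity) (fun x hx => csInf_le hbdd ⟨x, hx, rfl⟩)
      (fun x hx => (hneg x hx).le) (fun x hx => ?_) hh
    exact (norm_fst_le x).trans ((hRb x hx).trans (le_max_left _ _))
  · refine lambdaMinusD_le hΩ hψ ?_ (by linarith) ?_
    · have hset : {x | x ∈ Ω ∧ ψ₀ x ≤ -ε} = closure Ω ∩ ψ₀ ⁻¹' Iic (-ε) := by
        ext x
        refine ⟨fun hx => ⟨subset_closure hx.1, hx.2⟩, fun hx => ⟨?_, hx.2⟩⟩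
        by_contra hxΩ
        have h0 := hψ.bdry x ⟨hx.1, by rwa [hΩ.interior_eq]⟩
        have h1 : ψ₀ x ≤ -ε := hx.2
        linarith
      rw [hset]
      exact hcl.of_isClosed_subset
        (hψ.contOn.preimage_isClosed_of_isClosed isClosed_closure isClosed_Iic) inter_subset_left
    · obtain ⟨_, ⟨x, hx, rfl⟩, hxlt⟩ := exists_lt_of_csInf_lt (hne.image ψ₀)
        (lt_add_of_pos_right (sInf (ψ₀ '' Ω)) hε)
      exact ⟨x, hx, hxlt⟩
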